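/- Let ξ = exp(2πi/11), ν = (−1+i√11)/2, ℤ[ν] = {a + bν : a, b ∈ ℤ} ⊂ ℂ, and for k ∈ ℤ let v_k = (ξ^k, ξ^{9k}, ξ^{3k}, ξ^{4k}, ξ^{5k}) ∈ ℂ⁵. Then the additive subgroup of ℂ⁵ generated by the eleven vectors v₀, v₁, …, v₁₀ equals the ℤ[ν]-module ℤ[ν]v₀ + ℤ[ν]v₁ + ℤ[ν]v₂ + ℤ[ν]v₃ + ℤ[ν]v₄. -/

import Mathlib

/-- ξ = exp(2πi/11), a primitive 11th root of unity. -/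
noncomputable def ξ : ℂ := Complex.exp (2 * Real.pi * Complex.I / 11)

/-- ν = (−1 + i√11)/2. -/
noncomputable def ν : ℂ := (-1 + Complex.I * Real.sqrt 11) / 2

/-- ℤ[ν] = {a + bν : a, b ∈ ℤ} ⊂ ℂ. -/
noncomputable def Zν : Set ℂ := {z | ∃ a b : ℤ, z = (a : ℂ) + (b : ℂ) * ν}

/-- v_k = (ξ^k, ξ^{9k}, ξ^{3k}, ξ^{4k}, ξ^{5k}) ∈ ℂ⁵. -/
noncomputable def v (k : ℕ) : Fin 5 → ℂ := fun i => ξ ^ (k * ![1, 9, 3, 4, 5] i)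

/-- The Gaussian period `ξ + ξ³ + ξ⁴ + ξ⁵ + ξ⁹`. -/
noncomputable def gaussPeriod : ℂ := ξ + ξ ^ 3 + ξ ^ 4 + ξ ^ 5 + ξ ^ 9

lemma isPrimitiveRoot_ξ : IsPrimitiveRoot ξ 11 := by
  simpa [ξ] using Complex.isPrimitiveRoot_exp 11 (by norm_num)

lemma ξ_pow_eleven : ξ ^ 11 = 1 := isPrimitiveRoot_ξ.pow_eq_one

lemma ξ_geom_sum : 1 + ξ + ξ ^ 2 + ξ ^ 3 + ξ ^ 4 + ξ ^ 5 + ξ ^ 6 + ξ ^ 7 + ξ ^ 8 + ξ ^ 9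
    + ξ ^ 10 = 0 := by
  have h := isPrimitiveRoot_ξ.geom_sum_eq_zero (by norm_num)
  simpa [Finset.sum_range_succ] using h

lemma gaussPeriod_sq : gaussPeriod ^ 2 = -gaussPeriod - 3 := by
  unfold gaussPeriod
  linear_combination 3 * ξ_geom_sum + (2 * ξ + 2 * ξ ^ 2 + 2 * ξ ^ 3 + ξ ^ 7) * ξ_pow_eleven

lemma ν_sq : ν ^ 2 = -ν - 3 := by
  have h : ((Real.sqrt 11 : ℝ) : ℂ) ^ 2 = 11 := by
    rw [← Complex.ofReal_pow, Real.sq_sqrt (by norm_num)]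
    norm_num
  unfold ν
  linear_combination (Real.sqrt 11 : ℂ) ^ 2 / 4 * Complex.I_sq - h / 4

lemma ν_eq_or : ν = gaussPeriod ∨ ν = -1 - gaussPeriod := by
  have h : (ν - gaussPeriod) * (ν - (-1 - gaussPeriod)) = 0 := by
    linear_combination ν_sq - gaussPeriod_sq
  rcases mul_eq_zero.mp h with h | h
  · exact .inl (sub_eq_zero.mp h)
  · exact .inr (sub_eq_zero.mp h)

/-- `ℤ[ν]` does not depend on which of the two conjugate periods `ν` is. -/
lemma mem_Zν_iff {z : ℂ} : z ∈ Zν ↔ ∃ a b : ℤ, z = a + b * gaussPeriod := by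
  rcases ν_eq_or with h | h
  · simp only [Zν, Set.mem_ofPred_eq, h]
  · simp only [Zν, Set.mem_ofPred_eq, h]
    constructor <;>
    · rintro ⟨a, b, rfl⟩
      exact ⟨a - b, -b, by push_cast; ring⟩

lemma v_add_eleven (k : ℕ) : v (k + 11) = v k := by
  funext i
  simp only [v, add_mul, pow_add, pow_mul, ξ_pow_eleven, one_pow, mul_one]

lemma v_apply (k : ℕ) (i : Fin 5) : v k i = (ξ ^ ![1, 9, 3, 4, 5] i) ^ k := by
  rw [v, mul_comm, pow_mul]

/-- The Gaussian period is fixed by `ξ ↦ ξ ^ a` for `a` a nonzero square modulo 11. -/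
lemma gaussPeriod_eq_pow (i : Fin 5) : gaussPeriod = v 1 i + v 3 i + v 4 i + v 5 i + v 9 i := by
  have h (n : ℕ) : ξ ^ n = ξ ^ (n % 11) := pow_eq_pow_mod n ξ_pow_eleven
  fin_cases i <;> simp [v, gaussPeriod, h 12, h 15, h 16, h 20, h 25, h 27, h 36, h 45, h 81] <;>
    ring

lemma gaussPeriod_smul_v (k : ℕ) : gaussPeriod • v k
    = v (k + 1) + v (k + 3) + v (k + 4) + v (k + 5) + v (k + 9) := by
  funext i
  simp only [Pi.smul_apply, Pi.add_apply, smul_eq_mul, gaussPeriod_eq_pow i, v_apply]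
  ring

lemma sum_v_add (k : ℕ) : ∑ j ∈ Finset.range 11, v (k + j) = 0 := by
  funext i
  have hc : Nat.Coprime (![1, 9, 3, 4, 5] i) 11 := by fin_cases i <;> decide
  have h := (isPrimitiveRoot_ξ.pow_of_coprime _ hc).geom_sum_eq_zero (by norm_num)
  simp only [Finset.sum_apply, v_apply, pow_add, ← Finset.mul_sum, h, mul_zero, Pi.zero_apply]

/-- The recurrence given by the minimal polynomial of `ξ` over `ℚ(ν)`. -/
lemma v_add_five (k : ℕ) : v (k + 5) = gaussPeriod • v (k + 4) + v (k + 3) - v (k + 2)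
    + (v (k + 1) + gaussPeriod • v (k + 1)) + v k := by
  have h := sum_v_add k
  have h13 := v_add_eleven (k + 2)
  simp only [Finset.sum_range_succ, Finset.sum_range_zero, zero_add, add_zero] at h
  simp only [gaussPeriod_smul_v, add_assoc, Nat.reduceAdd] at h13 ⊢
  rw [h13]
  linear_combination -h

/-- The `ℤ[ν]`-span of `v₀, …, v₄`, as an additive group. -/
noncomputable def ZνSpan : AddSubgroup (Fin 5 → ℂ) where
  carrier := {x | ∃ c : Fin 5 → ℂ, (∀ j, c j ∈ Zν) ∧ x = ∑ j : Fin 5, c j • v j.val}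
  zero_mem' := ⟨0, fun _ => ⟨0, 0, by simp⟩, by simp⟩
  add_mem' := by
    rintro _ _ ⟨c, hc, rfl⟩ ⟨d, hd, rfl⟩
    refine ⟨c + d, fun j => ?_, by simp [add_smul, Finset.sum_add_distrib]⟩
    obtain ⟨a, b, h⟩ := hc j
    obtain ⟨a', b', h'⟩ := hd j
    exact ⟨a + a', b + b', by simp only [Pi.add_apply, h, h']; push_cast; ring⟩
  neg_mem' := by
    rintro _ ⟨c, hc, rfl⟩
    refine ⟨-c, fun j => ?_, by simp⟩
    obtain ⟨a, b, h⟩ := hc j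
    exact ⟨-a, -b, by simp only [Pi.neg_apply, h]; push_cast; ring⟩

lemma gaussPeriod_smul_mem_ZνSpan {x : Fin 5 → ℂ} (hx : x ∈ ZνSpan) :
    gaussPeriod • x ∈ ZνSpan := by
  obtain ⟨c, hc, rfl⟩ := hx
  refine ⟨gaussPeriod • c, fun j => ?_, by simp [Finset.smul_sum, mul_smul]⟩
  obtain ⟨a, b, h⟩ := mem_Zν_iff.mp (hc j)
  refine mem_Zν_iff.mpr ⟨-3 * b, a - b, ?_⟩
  simp only [Pi.smul_apply, smul_eq_mul, h]
  push_cast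
  linear_combination (b : ℂ) * gaussPeriod_sq

lemma v_mem_ZνSpan_of_lt (j : Fin 5) : v j.val ∈ ZνSpan := by
  refine ⟨Pi.single j 1, fun i => ?_, ?_⟩
  · obtain rfl | h := eq_or_ne i j
    · exact ⟨1, 0, by simp⟩
    · exact ⟨0, 0, by simp [h]⟩
  · simp [Pi.single_apply]

lemma v_mem_ZνSpan (k : ℕ) : v k ∈ ZνSpan := by
  induction k using Nat.strong_induction_on with
  | _ k ih =>
    rcases lt_or_ge k 5 with hk | hk
    · exact v_mem_ZνSpan_of_lt ⟨k, hk⟩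
    · obtain ⟨n, rfl⟩ := Nat.exists_eq_add_of_le' hk
      rw [v_add_five]
      have h (m : ℕ) (hm : m < 5) : v (n + m) ∈ ZνSpan := ih _ (by omega)
      exact add_mem (add_mem (sub_mem (add_mem (gaussPeriod_smul_mem_ZνSpan (h 4 (by omega)))
        (h 3 (by omega))) (h 2 (by omega))) (add_mem (h 1 (by omega))
        (gaussPeriod_smul_mem_ZνSpan (h 1 (by omega))))) (h 0 (by omega))

lemma v_mem_closure (k : ℕ) :
    v k ∈ AddSubgroup.closure (Set.range fun k : Fin 11 => v k.val) := by
  induction k using Nat.strong_induction_on with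
  | _ k ih =>
    rcases lt_or_ge k 11 with hk | hk
    · exact AddSubgroup.subset_closure ⟨⟨k, hk⟩, rfl⟩
    · obtain ⟨n, rfl⟩ := Nat.exists_eq_add_of_le' hk
      rw [v_add_eleven]
      exact ih n (by omega)

/-- the additive subgroup of ℂ⁵ generated by v₀, v₁, …, v₁₀ equals the
ℤ[ν]-module ℤ[ν]v₀ + ℤ[ν]v₁ + ℤ[ν]v₂ + ℤ[ν]v₃ + ℤ[ν]v₄. -/
theorem lattice_Lambda0_eq :
    (AddSubgroup.closure (Set.range fun k : Fin 11 => v k.val) : Set (Fin 5 → ℂ))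
      = {x | ∃ c : Fin 5 → ℂ, (∀ j, c j ∈ Zν) ∧ x = ∑ j : Fin 5, c j • v j.val} := by
  apply Set.Subset.antisymm
  · have h : AddSubgroup.closure (Set.range fun k : Fin 11 => v k.val) ≤ ZνSpan := by
      rw [AddSubgroup.closure_le]
      rintro _ ⟨k, rfl⟩
      exact v_mem_ZνSpan k
    exact h
  · rintro _ ⟨c, hc, rfl⟩
    refine sum_mem fun j _ => ?_
    obtain ⟨a, b, h⟩ := mem_Zν_iff.mp (hc j)
    rw [h, add_smul, mul_smul, gaussPeriod_smul_v, Int.cast_smul_eq_zsmul,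
      Int.cast_smul_eq_zsmul]
    refine add_mem (zsmul_mem (v_mem_closure _) _) (zsmul_mem ?_ _)
    exact add_mem (add_mem (add_mem (add_mem (v_mem_closure _) (v_mem_closure _))
      (v_mem_closure _)) (v_mem_closure _)) (v_mem_closure _)
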